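/- Let K be a finite field with q elements and L a field extension of K of degree 2. Let H be the group of pairs of matrices ( (a b₁; 0 d), (a b₂; 0 d) ) with a, d ∈ Kˣ, b₁ ∈ K, b₂ ∈ L, the first matrix in GL₂(K) and the second in GL₂(L), acting componentwise on ℙ¹(K) × ℙ¹(L). This action has exactly four orbits, represented by ([1:0], [1:0]), ([0:1], [0:1]), ([1:0], [0:1]) and ([0:1], [1:0]); their cardinalities are 1, q³, q², and q respectively. -/

import Mathlib

open scoped LinearAlgebra.Projectivization

/-- The action of `GL₂(F)` on the projective line `ℙ¹(F) = ℙ F (Fin 2 → F)`, induced by the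
linear action of an invertible matrix on `F²`. -/
noncomputable def pact {F : Type*} [Field F] (g : GL (Fin 2) F) :
    ℙ F (Fin 2 → F) → ℙ F (Fin 2 → F) :=
  Projectivization.map
    ((Matrix.GeneralLinearGroup.toLin g : LinearMap.GeneralLinearGroup F (Fin 2 → F)) :
      (Fin 2 → F) →ₗ[F] (Fin 2 → F))
    (LinearMap.GeneralLinearGroup.toLinearEquiv (Matrix.GeneralLinearGroup.toLin g)).injective

/-- The point `[1 : 0]` of the projective line over a field `F`. -/
noncomputable def ptOneZero (F : Type*) [Field F] : ℙ F (Fin 2 → F) :=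
  Projectivization.mk F ![1, 0] (fun h => by simpa using congrFun h 0)

/-- The point `[0 : 1]` of the projective line over a field `F`. -/
noncomputable def ptZeroOne (F : Type*) [Field F] : ℙ F (Fin 2 → F) :=
  Projectivization.mk F ![0, 1] (fun h => by simpa using congrFun h 1)

/-- The orbit of a point of `ℙ¹(K) × ℙ¹(L)` under the componentwise action of the group `H`
of pairs of upper-triangular matrices `((a b₁; 0 d), (a b₂; 0 d))` with `a, d ∈ Kˣ`,
`b₁ ∈ K`, `b₂ ∈ L`, the first in `GL₂(K)` and the second in `GL₂(L)`. -/
noncomputable def pairOrbit {K L : Type*} [Field K] [Field L] [Algebra K L]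
    (p : ℙ K (Fin 2 → K) × ℙ L (Fin 2 → L)) :
    Set (ℙ K (Fin 2 → K) × ℙ L (Fin 2 → L)) :=
  {p' | ∃ (g₁ : GL (Fin 2) K) (g₂ : GL (Fin 2) L),
    (g₁ : Matrix (Fin 2) (Fin 2) K) 1 0 = 0 ∧
    (g₂ : Matrix (Fin 2) (Fin 2) L) 1 0 = 0 ∧
    (g₂ : Matrix (Fin 2) (Fin 2) L) 0 0 = algebraMap K L ((g₁ : Matrix (Fin 2) (Fin 2) K) 0 0) ∧
    (g₂ : Matrix (Fin 2) (Fin 2) L) 1 1 = algebraMap K L ((g₁ : Matrix (Fin 2) (Fin 2) K) 1 1) ∧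
    (pact g₁ p.1, pact g₂ p.2) = p'}

/-- The affine point `[x : 1]` of the projective line. -/
noncomputable def affinePt {F : Type*} [Field F] (x : F) : ℙ F (Fin 2 → F) :=
  Projectivization.mk F ![x, 1] (fun h => by simpa using congrFun h 1)

section ProjectiveLine

variable {F : Type*} [Field F]

lemma affinePt_ne_ptOneZero (x : F) : affinePt x ≠ ptOneZero F := by
  intro h
  obtain ⟨a, ha⟩ := (Projectivization.mk_eq_mk_iff' F _ _ _ _).1 h
  simpa using congrFun ha 1

lemma affinePt_injective : Function.Injective (affinePt : F → ℙ F (Fin 2 → F)) := by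
  intro x y h
  obtain ⟨a, ha⟩ := (Projectivization.mk_eq_mk_iff' F _ _ _ _).1 h
  have h0 := congrFun ha 0
  have h1 : a = 1 := by simpa using congrFun ha 1
  simpa [h1] using h0.symm

lemma eq_ptOneZero_or_exists_affinePt (p : ℙ F (Fin 2 → F)) :
    p = ptOneZero F ∨ ∃ x, p = affinePt x := by
  induction p using Projectivization.ind with
  | h v hv =>
    by_cases h1 : v 1 = 0
    · left
      refine (Projectivization.mk_eq_mk_iff' F _ _ _ _).2 ⟨v 0, ?_⟩
      ext i
      fin_cases i <;> simp [h1]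
    · right
      refine ⟨v 0 / v 1, (Projectivization.mk_eq_mk_iff' F _ _ _ _).2 ⟨v 1, ?_⟩⟩
      ext i
      fin_cases i <;> simp
      field_simp

lemma ptZeroOne_ne_ptOneZero : ptZeroOne F ≠ ptOneZero F :=
  affinePt_ne_ptOneZero 0

lemma natCard_ne_ptOneZero : Nat.card {p : ℙ F (Fin 2 → F) // p ≠ ptOneZero F} = Nat.card F := by
  refine (Nat.card_eq_of_bijective
    (fun x : F => (⟨affinePt x, affinePt_ne_ptOneZero x⟩ : {p // p ≠ ptOneZero F}))
    ⟨fun x y h => affinePt_injective (congrArg Subtype.val h), ?_⟩).symm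
  rintro ⟨p, hp⟩
  obtain rfl | ⟨x, rfl⟩ := eq_ptOneZero_or_exists_affinePt p
  · exact absurd rfl hp
  · exact ⟨x, rfl⟩

lemma pact_injective (g : GL (Fin 2) F) : Function.Injective (pact g) :=
  Projectivization.map_injective _ _

lemma pact_ptOneZero {g : GL (Fin 2) F} (hg : (g : Matrix (Fin 2) (Fin 2) F) 1 0 = 0) :
    pact g (ptOneZero F) = ptOneZero F := by
  refine (Projectivization.mk_eq_mk_iff' F _ _ _ _).2 ⟨(g : Matrix (Fin 2) (Fin 2) F) 0 0, ?_⟩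
  ext i
  fin_cases i <;> simp [hg]

lemma pact_eq_ptOneZero_iff {g : GL (Fin 2) F} (hg : (g : Matrix (Fin 2) (Fin 2) F) 1 0 = 0)
    (p : ℙ F (Fin 2 → F)) : pact g p = ptOneZero F ↔ p = ptOneZero F := by
  rw [← (pact_injective g).eq_iff (a := p), pact_ptOneZero hg]

lemma pact_upperRightHom_affinePt (b x : F) :
    pact (Matrix.GeneralLinearGroup.upperRightHom b) (affinePt x) =
      affinePt (x + b) := by
  refine (Projectivization.mk_eq_mk_iff' F _ _ _ _).2 ⟨1, ?_⟩
  ext i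
  fin_cases i <;> simp [Matrix.GeneralLinearGroup.upperRightHom]

lemma exists_pact_upperRightHom_eq {p p' : ℙ F (Fin 2 → F)}
    (h : p' = ptOneZero F ↔ p = ptOneZero F) :
    ∃ b : F, pact (Matrix.GeneralLinearGroup.upperRightHom b) p = p' := by
  obtain rfl | ⟨x, rfl⟩ := eq_ptOneZero_or_exists_affinePt p
  · exact ⟨0, by rw [h.2 rfl]; exact pact_ptOneZero (by simp)⟩
  · obtain rfl | ⟨y, rfl⟩ := eq_ptOneZero_or_exists_affinePt p'
    · exact absurd (h.1 rfl) (affinePt_ne_ptOneZero x)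
    · exact ⟨y - x, by rw [pact_upperRightHom_affinePt, add_sub_cancel]⟩

end ProjectiveLine

lemma pairOrbit_eq {K L : Type*} [Field K] [Field L] [Algebra K L]
    (p : ℙ K (Fin 2 → K) × ℙ L (Fin 2 → L)) :
    pairOrbit p = {x | x = ptOneZero K ↔ p.1 = ptOneZero K} ×ˢ
      {y | y = ptOneZero L ↔ p.2 = ptOneZero L} := by
  ext p'
  constructor
  · rintro ⟨g₁, g₂, h₁, h₂, -, -, rfl⟩
    exact ⟨pact_eq_ptOneZero_iff h₁ _, pact_eq_ptOneZero_iff h₂ _⟩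
  · rintro ⟨h₁, h₂⟩
    obtain ⟨b₁, hb₁⟩ := exists_pact_upperRightHom_eq h₁
    obtain ⟨b₂, hb₂⟩ := exists_pact_upperRightHom_eq h₂
    exact ⟨_, _, by simp, by simp, by simp, by simp, Prod.ext hb₁ hb₂⟩


/-- Section 5.2 of the paper (the orbits of `G_i`, `i ≥ 2`, on `ℙ¹(𝔽_q) × ℙ¹(𝔽_{q²})`):
the group of pairs of upper-triangular matrices with matching diagonals acting
componentwise on `ℙ¹(K) × ℙ¹(L)` has exactly four orbits, represented by
`([1:0],[1:0])`, `([0:1],[0:1])`, `([1:0],[0:1])`, `([0:1],[1:0])`, of cardinalities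
`1`, `q³`, `q²`, `q` respectively. -/
theorem pair_group_orbits (K L : Type*) [Field K] [Field L] [Algebra K L]
    [Fintype K] (q : ℕ) (hq : Fintype.card K = q) (hdim : Module.finrank K L = 2) :
    let r₁ : ℙ K (Fin 2 → K) × ℙ L (Fin 2 → L) := (ptOneZero K, ptOneZero L)
    let r₂ : ℙ K (Fin 2 → K) × ℙ L (Fin 2 → L) := (ptZeroOne K, ptZeroOne L)
    let r₃ : ℙ K (Fin 2 → K) × ℙ L (Fin 2 → L) := (ptOneZero K, ptZeroOne L)
    let r₄ : ℙ K (Fin 2 → K) × ℙ L (Fin 2 → L) := (ptZeroOne K, ptOneZero L)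
    (∀ p, pairOrbit p = pairOrbit r₁ ∨ pairOrbit p = pairOrbit r₂ ∨
      pairOrbit p = pairOrbit r₃ ∨ pairOrbit p = pairOrbit r₄) ∧
    (List.Pairwise (· ≠ ·) [pairOrbit r₁, pairOrbit r₂, pairOrbit r₃, pairOrbit r₄]) ∧
    Nat.card (pairOrbit r₁) = 1 ∧ Nat.card (pairOrbit r₂) = q ^ 3 ∧
    Nat.card (pairOrbit r₃) = q ^ 2 ∧ Nat.card (pairOrbit r₄) = q := by
  intro r₁ r₂ r₃ r₄
  have hK : Nat.card K = q := by rw [Nat.card_eq_fintype_card, hq]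
  have : Module.Finite K L := Module.finite_of_finrank_pos (by simp [hdim])
  have hL : Nat.card L = q ^ 2 := by rw [Module.natCard_eq_pow_finrank (K := K), hK, hdim]
  have hK₀ := ptZeroOne_ne_ptOneZero (F := K)
  have hL₀ := ptZeroOne_ne_ptOneZero (F := L)
  have hKc : Nat.card {x : ℙ K (Fin 2 → K) | x ≠ ptOneZero K} = q :=
    natCard_ne_ptOneZero.trans hK
  have hLc : Nat.card {y : ℙ L (Fin 2 → L) | y ≠ ptOneZero L} = q ^ 2 :=
    natCard_ne_ptOneZero.trans hL
  have e₁ : pairOrbit r₁ = {x | x = ptOneZero K} ×ˢ {y | y = ptOneZero L} := by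
    simp [pairOrbit_eq, r₁]
  have e₂ : pairOrbit r₂ = {x | x ≠ ptOneZero K} ×ˢ {y | y ≠ ptOneZero L} := by
    simp [pairOrbit_eq, r₂, hK₀, hL₀]
  have e₃ : pairOrbit r₃ = {x | x = ptOneZero K} ×ˢ {y | y ≠ ptOneZero L} := by
    simp [pairOrbit_eq, r₃, hL₀]
  have e₄ : pairOrbit r₄ = {x | x ≠ ptOneZero K} ×ˢ {y | y = ptOneZero L} := by
    simp [pairOrbit_eq, r₄, hK₀]
  have card_prod (s : Set (ℙ K (Fin 2 → K))) (t : Set (ℙ L (Fin 2 → L))) :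
      Nat.card (s ×ˢ t : Set _) = Nat.card s * Nat.card t := by
    rw [Nat.card_congr (Equiv.Set.prod s t), Nat.card_prod]
  have m₁ : r₁ ∈ pairOrbit r₁ := by simp [pairOrbit_eq]
  have m₂ : r₂ ∈ pairOrbit r₂ := by simp [pairOrbit_eq]
  have m₃ : r₃ ∈ pairOrbit r₃ := by simp [pairOrbit_eq]
  refine ⟨fun p => ?_, ?_, ?_, ?_, ?_, ?_⟩
  · rw [e₁, e₂, e₃, e₄, pairOrbit_eq]
    by_cases h₁ : p.1 = ptOneZero K <;> by_cases h₂ : p.2 = ptOneZero L <;> simp [h₁, h₂]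
  · have n₁₂ : pairOrbit r₁ ≠ pairOrbit r₂ := fun h => by
      rw [h, e₂] at m₁; simp [r₁] at m₁
    have n₁₃ : pairOrbit r₁ ≠ pairOrbit r₃ := fun h => by
      rw [h, e₃] at m₁; simp [r₁] at m₁
    have n₁₄ : pairOrbit r₁ ≠ pairOrbit r₄ := fun h => by
      rw [h, e₄] at m₁; simp [r₁] at m₁
    have n₂₃ : pairOrbit r₂ ≠ pairOrbit r₃ := fun h => by
      rw [h, e₃] at m₂; simp [r₂, hK₀] at m₂
    have n₂₄ : pairOrbit r₂ ≠ pairOrbit r₄ := fun h => by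
      rw [h, e₄] at m₂; simp [r₂, hL₀] at m₂
    have n₃₄ : pairOrbit r₃ ≠ pairOrbit r₄ := fun h => by
      rw [h, e₄] at m₃; simp [r₃] at m₃
    simp only [List.pairwise_cons, List.mem_cons, List.not_mem_nil]
    grind
  · rw [e₁, card_prod]; simp
  · rw [e₂, card_prod, hKc, hLc]; ring
  · rw [e₃, card_prod, hLc]; simp
  · rw [e₄, card_prod, hKc]; simp
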